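/- Basic resonance estimate (Lemma 3.8): Let 1 < α ≤ 2 and fix signs ε_123, ε_1, ε_2, ε_3 ∈ {−1,+1}. There exist θ > 0 and C > 0, depending only on α (uniform in the sign choice), such that for all n_1, n_2 ∈ ℤ³ and all dyadic numbers N_3 ≥ 1, Σ_{n′ ∈ ℤ} Σ_{n_3 ∈ ℤ³} ⟨n′⟩^{−1} · 1_{|n_3| ∼ N_3} · ⟪n_1+n_2+n_3⟫^{−1} · ⟪n_3⟫^{−2} · 1_{|κ_2(n_1,n_2,n_3) − n′| ≤ 1} ≤ C · N_3^{−θ} · ⟨n_1+n_2⟩^{−α}. -/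

import Mathlib

noncomputable section

open scoped BigOperators

/-- Japanese bracket of a real number: `⟨x⟩ = (1 + x²)^{1/2}`. -/
def rjb (x : ℝ) : ℝ := Real.sqrt (1 + x ^ 2)

/-- Euclidean norm of a lattice point in `ℤ³`. -/
def znorm (n : Fin 3 → ℤ) : ℝ := Real.sqrt (∑ i, ((n i : ℝ)) ^ 2)

/-- Japanese bracket `⟨n⟩ = (1 + |n|²)^{1/2}` of a lattice point in `ℤ³`. -/
def jb (n : Fin 3 → ℤ) : ℝ := Real.sqrt (1 + ∑ i, ((n i : ℝ)) ^ 2)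

/-- The modified bracket `⟪n⟫ = (⟨n⟩^{2α} − 1/4)^{1/2}`. -/
def jbb (α : ℝ) (n : Fin 3 → ℤ) : ℝ := Real.sqrt (jb n ^ (2 * α) - 1 / 4)

/-- Dyadic numbers `2^j`, `j ≥ 0`. -/
def IsDyadic (N : ℝ) : Prop := ∃ j : ℕ, N = 2 ^ j

/-- `|n| ∼ N` for a dyadic number `N`: `N/2 < |n| ≤ N` if `N ≥ 2`, and `|n| ≤ 1` if `N = 1`. -/
def SimFreq (N : ℝ) (n : Fin 3 → ℤ) : Prop :=
  (2 ≤ N ∧ N / 2 < znorm n ∧ znorm n ≤ N) ∨ (N < 2 ∧ znorm n ≤ 1)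

/-- `x` is a sign `±1`. -/
def IsSign (x : ℝ) : Prop := x = 1 ∨ x = -1

open Classical in
/-- Real-valued indicator of a proposition. -/
def ind (p : Prop) : ℝ := if p then 1 else 0

section analytic
variable {E : Type*} [NormedAddCommGroup E] [InnerProductSpace ℝ E]

theorem norm_rpow_smul_sub_le {α : ℝ} (hα₁ : 1 < α) (hα₂ : α ≤ 2) {p q : E}
    (hp : 0 < ‖p‖) (hqp : ‖q‖ ≤ ‖p‖) :
    ‖‖p‖ ^ (α - 2) • p - ‖q‖ ^ (α - 2) • q - ‖p‖ ^ (α - 2) • (p - q)‖ ≤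
      (2 - α) * ‖p‖ ^ (α - 2) * ‖p - q‖ := by
  have ha : 0 < ‖p‖ ^ (α - 2) := Real.rpow_pos_of_pos hp _
  have hsub : ‖p‖ - ‖q‖ ≤ ‖p - q‖ := norm_sub_norm_le p q
  have heq : ‖p‖ ^ (α - 2) • p - ‖q‖ ^ (α - 2) • q - ‖p‖ ^ (α - 2) • (p - q) =
      (‖p‖ ^ (α - 2) - ‖q‖ ^ (α - 2)) • q := by module
  rw [heq, norm_smul, Real.norm_eq_abs]
  rcases (norm_nonneg q).eq_or_lt with hq | hq
  · rw [← hq, mul_zero]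
    have := norm_nonneg (p - q)
    have : 0 ≤ 2 - α := by linarith
    positivity
  have hab : ‖p‖ ^ (α - 2) ≤ ‖q‖ ^ (α - 2) :=
    Real.rpow_le_rpow_of_nonpos hq hqp (by linarith)
  rw [abs_of_nonpos (by linarith)]
  have hamgm := Real.geom_mean_le_arith_mean2_weighted (w₁ := α - 1) (w₂ := 2 - α)
    (by linarith) (by linarith) hq.le hp.le (by ring)
  have hcancel : ‖p‖ ^ (α - 2) * ‖p‖ ^ (2 - α) = 1 := by
    rw [← Real.rpow_add hp]; simp
  have hbq : ‖q‖ ^ (α - 2) * ‖q‖ = ‖q‖ ^ (α - 1) := by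
    rw [← Real.rpow_add_one hq.ne']; congr 1; ring
  have hkey : ‖q‖ ^ (α - 1) ≤ ‖p‖ ^ (α - 2) * ((α - 1) * ‖q‖ + (2 - α) * ‖p‖) := by
    calc ‖q‖ ^ (α - 1) = ‖p‖ ^ (α - 2) * (‖q‖ ^ (α - 1) * ‖p‖ ^ (2 - α)) := by
          rw [mul_left_comm, hcancel, mul_one]
      _ ≤ _ := by gcongr
  have h2 : (2 - α) * ‖p‖ ^ (α - 2) * (‖p‖ - ‖q‖) ≤ (2 - α) * ‖p‖ ^ (α - 2) * ‖p - q‖ := by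
    have : 0 ≤ 2 - α := by linarith
    gcongr
  nlinarith

/-- The gradient field of `‖x‖ ^ α` is strongly monotone, also when tested against vectors `v`
that make a sufficiently small angle with `p - q`. -/
theorem inner_norm_rpow_smul_sub_ge {α : ℝ} (hα₁ : 1 < α) (hα₂ : α ≤ 2) {p q v : E} {R : ℝ}
    (hp : ‖p‖ ≤ R) (hq : ‖q‖ ≤ R)
    (hv : (1 - (α - 1) / 2) * (‖v‖ * ‖p - q‖) ≤ inner ℝ v (p - q)) :
    (α - 1) / 2 * R ^ (α - 2) * (‖v‖ * ‖p - q‖) ≤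
      inner ℝ v (‖p‖ ^ (α - 2) • p - ‖q‖ ^ (α - 2) • q) := by
  wlog hqp : ‖q‖ ≤ ‖p‖ generalizing p q v with H
  · have hv' : (1 - (α - 1) / 2) * (‖-v‖ * ‖q - p‖) ≤ inner ℝ (-v) (q - p) := by
      rw [norm_neg, norm_sub_rev q p, inner_neg_left, ← inner_neg_right, neg_sub]
      exact hv
    have := H hq hp hv' (le_of_not_ge hqp)
    rw [norm_neg, norm_sub_rev q p, inner_neg_left, ← inner_neg_right, neg_sub] at this
    exact this
  rcases (norm_nonneg p).eq_or_lt with hp0 | hp0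
  · have h1 : p = 0 := norm_eq_zero.mp hp0.symm
    have h2 : q = 0 := norm_eq_zero.mp (le_antisymm (by rwa [← hp0] at hqp) (norm_nonneg q))
    simp [h1, h2]
  have ha : 0 < ‖p‖ ^ (α - 2) := Real.rpow_pos_of_pos hp0 _
  have hle := norm_rpow_smul_sub_le hα₁ hα₂ hp0 hqp
  set D := ‖p‖ ^ (α - 2) • p - ‖q‖ ^ (α - 2) • q with hD
  have hcs := abs_real_inner_le_norm v (D - ‖p‖ ^ (α - 2) • (p - q))
  rw [inner_sub_right, inner_smul_right] at hcs
  have h1 := (abs_le.mp hcs).1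
  have h2 : ‖v‖ * ‖D - ‖p‖ ^ (α - 2) • (p - q)‖ ≤
      ‖v‖ * ((2 - α) * ‖p‖ ^ (α - 2) * ‖p - q‖) := by gcongr
  have h3 := mul_le_mul_of_nonneg_left hv ha.le
  have hR : R ^ (α - 2) ≤ ‖p‖ ^ (α - 2) :=
    Real.rpow_le_rpow_of_nonpos hp0 hp (by linarith)
  have h4 : (α - 1) / 2 * R ^ (α - 2) * (‖v‖ * ‖p - q‖) ≤
      (α - 1) / 2 * ‖p‖ ^ (α - 2) * (‖v‖ * ‖p - q‖) := by
    have : 0 ≤ (α - 1) / 2 := by linarith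
    gcongr
  nlinarith

theorem hasDerivAt_norm_add_smul_rpow {α : ℝ} (hα : 1 < α) (p v : E) (t : ℝ) :
    HasDerivAt (fun t : ℝ => ‖p + t • v‖ ^ α)
      (α * inner ℝ v (‖p + t • v‖ ^ (α - 2) • (p + t • v))) t := by
  have h1 : HasDerivAt (fun t : ℝ => p + t • v) v t := by
    simpa using ((hasDerivAt_id t).smul_const v).const_add p
  have h2 := (hasFDerivAt_norm_rpow (p + t • v) hα).comp_hasDerivAt t h1
  refine h2.congr_deriv ?_
  rw [inner_smul_right, real_inner_comm]
  simp [-map_add]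
  ring

theorem norm_add_smul_le_segment {x w : E} {t s : ℝ} (ht : 0 ≤ t) (hts : t ≤ s) (hs : 0 < s) :
    ‖x + t • w‖ ≤ (1 - t / s) * ‖x‖ + t / s * ‖x + s • w‖ := by
  have h1 : 0 ≤ t / s := by positivity
  have h2 : t / s ≤ 1 := (div_le_one hs).mpr hts
  have heq : x + t • w = (1 - t / s) • x + (t / s) • (x + s • w) := by
    rw [smul_add, smul_smul, div_mul_cancel₀ t hs.ne']
    module
  calc ‖x + t • w‖ ≤ ‖(1 - t / s) • x‖ + ‖(t / s) • (x + s • w)‖ := by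
        rw [heq]; exact norm_add_le _ _
    _ = _ := by
        rw [norm_smul, norm_smul, Real.norm_of_nonneg h1, Real.norm_of_nonneg (by linarith)]

theorem norm_add_smul_le_of_endpoints {x w : E} {t s R : ℝ} (ht : 0 ≤ t) (hts : t ≤ s)
    (hs : 0 < s) (hx : ‖x‖ ≤ R) (hx' : ‖x + s • w‖ ≤ R) : ‖x + t • w‖ ≤ R := by
  have h1 : 0 ≤ t / s := by positivity
  have h2 : t / s ≤ 1 := (div_le_one hs).mpr hts
  have := norm_add_smul_le_segment (x := x) (w := w) ht hts hs
  nlinarith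

/-- A circular cone around `v` is convex, and the norm of a point on a segment in the cone is
controlled from below by the norms of the endpoints. -/
theorem cone_segment {c ζ : ℝ} (hc : 1 / 2 ≤ c) (hζ : 0 ≤ ζ) {v x w : E} {t s : ℝ}
    (ht : 0 ≤ t) (hts : t ≤ s) (hs : 0 < s) (hx : ζ ≤ ‖x‖) (hx' : ζ ≤ ‖x + s • w‖)
    (hv : c * (‖v‖ * ‖x‖) ≤ inner ℝ v x)
    (hv' : c * (‖v‖ * ‖x + s • w‖) ≤ inner ℝ v (x + s • w)) :
    c * (‖v‖ * ‖x + t • w‖) ≤ inner ℝ v (x + t • w) ∧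
      ‖v‖ * (ζ / 2) ≤ ‖v‖ * ‖x + t • w‖ := by
  have h1 : 0 ≤ t / s := by positivity
  have h2 : 0 ≤ 1 - t / s := sub_nonneg.mpr ((div_le_one hs).mpr hts)
  have hn := norm_add_smul_le_segment (x := x) (w := w) ht hts hs
  have hin : inner ℝ v (x + t • w) =
      (1 - t / s) * inner ℝ v x + t / s * inner ℝ v (x + s • w) := by
    simp only [inner_add_right, inner_smul_right]
    field_simp
    ring
  have hv0 := norm_nonneg v
  have hlow : (1 - t / s) * (c * (‖v‖ * ‖x‖)) + t / s * (c * (‖v‖ * ‖x + s • w‖)) ≤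
      inner ℝ v (x + t • w) := by
    rw [hin]
    gcongr
  constructor
  · refine le_trans ?_ hlow
    have : c * (‖v‖ * ‖x + t • w‖) ≤
        c * (‖v‖ * ((1 - t / s) * ‖x‖ + t / s * ‖x + s • w‖)) := by gcongr
    linarith
  · refine le_trans ?_ ((hlow.trans (le_abs_self _)).trans (abs_real_inner_le_norm v _))
    have e1 : (1 - t / s) * (1 / 2 * (‖v‖ * ζ)) ≤ (1 - t / s) * (c * (‖v‖ * ‖x‖)) := by gcongr
    have e2 : t / s * (1 / 2 * (‖v‖ * ζ)) ≤ t / s * (c * (‖v‖ * ‖x + s • w‖)) := by gcongr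
    linarith

theorem norm_rpow_sub_increment_ge {α : ℝ} (hα₁ : 1 < α) (hα₂ : α ≤ 2) {σ : ℝ} (hσ : σ = 1 ∨ σ = -1)
    {p q v : E} {R ζ s : ℝ} (hs : 0 ≤ s)
    (hp : ‖p‖ ≤ R) (hq : ‖q‖ ≤ R) (hp' : ‖p + s • v‖ ≤ R) (hq' : ‖q + (σ * s) • v‖ ≤ R)
    (hR : 0 < R) (hζ : 0 ≤ ζ)
    (hz : ζ ≤ ‖p - q‖) (hz' : ζ ≤ ‖p - q + ((1 - σ) * s) • v‖)
    (hv : (1 - (α - 1) / 2) * (‖v‖ * ‖p - q‖) ≤ inner ℝ v (p - q))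
    (hv' : (1 - (α - 1) / 2) * (‖v‖ * ‖p - q + ((1 - σ) * s) • v‖) ≤
      inner ℝ v (p - q + ((1 - σ) * s) • v)) :
    (α - 1) / 4 * R ^ (α - 2) * ‖v‖ * ζ * s ≤
      (‖p + s • v‖ ^ α - σ * ‖q + (σ * s) • v‖ ^ α) - (‖p‖ ^ α - σ * ‖q‖ ^ α) := by
  rcases hs.eq_or_lt with rfl | hs0
  · simp
  have hσσ : σ * σ = 1 := by rcases hσ with rfl | rfl <;> norm_num
  set f : ℝ → ℝ := fun t => ‖p + t • v‖ ^ α - σ * ‖q + t • (σ • v)‖ ^ α with hf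
  have hd : ∀ t, HasDerivAt f (α * inner ℝ v (‖p + t • v‖ ^ (α - 2) • (p + t • v) -
      ‖q + t • (σ • v)‖ ^ (α - 2) • (q + t • (σ • v)))) t := by
    intro t
    refine ((hasDerivAt_norm_add_smul_rpow hα₁ p v t).sub
      ((hasDerivAt_norm_add_smul_rpow hα₁ q (σ • v) t).const_mul σ)).congr_deriv ?_
    rw [inner_sub_right, real_inner_smul_left]
    linear_combination (-α * inner ℝ v (‖q + t • (σ • v)‖ ^ (α - 2) • (q + t • (σ • v)))) * hσσ
  have hder : ∀ t ∈ interior (Set.Icc 0 s),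
      (α - 1) / 4 * R ^ (α - 2) * ‖v‖ * ζ ≤ deriv f t := by
    intro t ht
    obtain ⟨ht0, hts⟩ := interior_subset ht
    have hpt := norm_add_smul_le_of_endpoints ht0 hts hs0 hp hp'
    have hqt := norm_add_smul_le_of_endpoints (w := σ • v) ht0 hts hs0 hq
      (by rwa [smul_smul, mul_comm s])
    have hw : ((1 - σ) * s) • v = s • ((1 - σ) • v) := by rw [smul_smul, mul_comm]
    rw [hw] at hz' hv'
    obtain ⟨hc1, hc2⟩ := cone_segment (w := (1 - σ) • v) (by linarith) hζ ht0 hts hs0 hz hz' hv hv'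
    have hzt : p - q + t • ((1 - σ) • v) = (p + t • v) - (q + t • (σ • v)) := by module
    rw [hzt] at hc1 hc2
    have hmain := inner_norm_rpow_smul_sub_ge hα₁ hα₂ hpt hqt hc1
    rw [(hd t).deriv]
    have hRp : 0 < R ^ (α - 2) := Real.rpow_pos_of_pos hR _
    have hδ : 0 < α - 1 := by linarith
    have hlow : (α - 1) / 2 * R ^ (α - 2) * (‖v‖ * (ζ / 2)) ≤
        (α - 1) / 2 * R ^ (α - 2) * (‖v‖ * ‖(p + t • v) - (q + t • (σ • v))‖) := by gcongr
    have hnn : 0 ≤ (α - 1) / 2 * R ^ (α - 2) * (‖v‖ * (ζ / 2)) := by positivity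
    nlinarith
  have hmv := (convex_Icc 0 s).mul_sub_le_image_sub_of_le_deriv
    (fun t _ => (hd t).continuousAt.continuousWithinAt)
    (fun t _ => (hd t).differentiableAt.differentiableWithinAt) hder
    0 (Set.left_mem_Icc.mpr hs) s (Set.right_mem_Icc.mpr hs) hs
  simpa [hf, smul_smul, mul_comm s] using hmv
end analytic

section counting

theorem exists_sum_inv_one_add_abs_le {τ : ℝ} (hτ : 0 < τ) :
    ∃ C : ℝ, 0 < C ∧ ∀ (Y : Finset ℤ) (L : ℝ), 1 ≤ L → (Y.card : ℝ) ≤ L →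
      ∑ y ∈ Y, (1 + |(y : ℝ)|)⁻¹ ≤ C * L ^ τ := by
  have hsum : Summable fun y : ℤ => (1 + |(y : ℝ)|) ^ (-(1 + τ)) := by
    refine ((Real.summable_abs_int_rpow (b := 1 + τ) (by linarith)).add
      (summable_of_ne_finset_zero (s := {0}) (f := fun y : ℤ => if y = 0 then (1 : ℝ) else 0)
        (fun y hy => by simpa using hy))).of_nonneg_of_le (fun y => by positivity) ?_
    intro y
    by_cases hy : y = 0
    · subst hy
      simp
      positivity
    · have hy' : 0 < |(y : ℝ)| := by positivity
      simp only [hy, if_false, add_zero]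
      exact Real.rpow_le_rpow_of_nonpos hy' (by linarith) (by linarith)
  refine ⟨∑' y : ℤ, (1 + |(y : ℝ)|) ^ (-(1 + τ)) + 1, ?_, ?_⟩
  · have : 0 ≤ ∑' y : ℤ, (1 + |(y : ℝ)|) ^ (-(1 + τ)) := tsum_nonneg fun y => by positivity
    linarith
  intro Y L hL hY
  have hL0 : 0 < L := by linarith
  have hterm : ∀ y : ℤ, (1 + |(y : ℝ)|)⁻¹ ≤ L ^ τ * (1 + |(y : ℝ)|) ^ (-(1 + τ)) + L⁻¹ := by
    intro y
    have hpos : 0 < 1 + |(y : ℝ)| := by positivity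
    rcases le_total (1 + |(y : ℝ)|) L with h | h
    · have h1 : (1 + |(y : ℝ)|)⁻¹ = (1 + |(y : ℝ)|) ^ τ * (1 + |(y : ℝ)|) ^ (-(1 + τ)) := by
        rw [← Real.rpow_add hpos, ← Real.rpow_neg_one]
        congr 1; ring
      have h2 : (1 + |(y : ℝ)|) ^ τ ≤ L ^ τ := Real.rpow_le_rpow hpos.le h hτ.le
      have h3 : (1 + |(y : ℝ)|) ^ τ * (1 + |(y : ℝ)|) ^ (-(1 + τ)) ≤
          L ^ τ * (1 + |(y : ℝ)|) ^ (-(1 + τ)) := by gcongr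
      have : 0 < L⁻¹ := by positivity
      linarith
    · have h1 : (1 + |(y : ℝ)|)⁻¹ ≤ L⁻¹ := by gcongr
      have : 0 ≤ L ^ τ * (1 + |(y : ℝ)|) ^ (-(1 + τ)) := by positivity
      linarith
  calc ∑ y ∈ Y, (1 + |(y : ℝ)|)⁻¹
      ≤ ∑ y ∈ Y, (L ^ τ * (1 + |(y : ℝ)|) ^ (-(1 + τ)) + L⁻¹) :=
        Finset.sum_le_sum fun y _ => hterm y
    _ = L ^ τ * ∑ y ∈ Y, (1 + |(y : ℝ)|) ^ (-(1 + τ)) + Y.card * L⁻¹ := by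
        rw [Finset.sum_add_distrib, Finset.mul_sum, Finset.sum_const, nsmul_eq_mul]
    _ ≤ L ^ τ * ∑' y : ℤ, (1 + |(y : ℝ)|) ^ (-(1 + τ)) + 1 := by
        gcongr
        · exact hsum.sum_le_tsum Y (fun y _ => by positivity)
        · rw [← div_eq_mul_inv]; exact (div_le_one hL0).mpr hY
    _ ≤ _ := by
        have : 1 ≤ L ^ τ := Real.one_le_rpow hL hτ.le
        linarith

/-- If the values of `h` on `X` are separated along an integer coordinate `u`, then the sum of
`(1 + |h|)⁻¹` is controlled by a harmonic sum. -/
theorem sum_inv_one_add_abs_le_of_separated {ι : Type*} (X : Finset ι) (u : ι → ℤ)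
    (hu : Set.InjOn u X) (h : ι → ℝ) {η B : ℝ} (hη : 0 < η)
    (hsep : ∀ x ∈ X, ∀ y ∈ X, η * |(u x : ℝ) - u y| ≤ |h x - h y|)
    (hB : ∀ Y : Finset ℤ, Y.card ≤ X.card → ∑ y ∈ Y, (1 + |(y : ℝ)|)⁻¹ ≤ B) :
    ∑ x ∈ X, (1 + |h x|)⁻¹ ≤ (1 + 2 / η) * B := by
  rcases X.eq_empty_or_nonempty with rfl | hX
  · have := hB ∅ (by simp)
    simp at this ⊢
    positivity
  obtain ⟨x₀, hx₀, hmin⟩ := X.exists_min_image (fun x => |h x|) hX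
  have hterm : ∀ x ∈ X, (1 + |h x|)⁻¹ ≤ (1 + 2 / η) * (1 + |((u x - u x₀ : ℤ) : ℝ)|)⁻¹ := by
    intro x hx
    have h1 := hsep x hx x₀ hx₀
    have h2 : |h x - h x₀| ≤ 2 * |h x| := by
      have := abs_sub (h x) (h x₀)
      have := hmin x hx
      linarith
    push_cast
    set d := |(u x : ℝ) - u x₀|
    have hd : 0 ≤ d := abs_nonneg _
    rw [← div_eq_mul_inv, inv_eq_one_div, div_le_div_iff₀ (by positivity) (by positivity)]
    have h3 : d ≤ 2 / η * |h x| := by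
      rw [div_mul_eq_mul_div, le_div_iff₀ hη]; linarith
    have h4 : 0 < 2 / η := by positivity
    nlinarith [abs_nonneg (h x)]
  calc ∑ x ∈ X, (1 + |h x|)⁻¹
      ≤ ∑ x ∈ X, (1 + 2 / η) * (1 + |((u x - u x₀ : ℤ) : ℝ)|)⁻¹ := Finset.sum_le_sum hterm
    _ = (1 + 2 / η) * ∑ y ∈ X.image (fun x => u x - u x₀), (1 + |(y : ℝ)|)⁻¹ := by
        rw [← Finset.mul_sum, Finset.sum_image]
        intro x hx y hy hxy
        exact hu hx hy (by simpa using hxy)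
    _ ≤ _ := by
        gcongr
        exact hB _ Finset.card_image_le

theorem card_le_of_injOn_int {ι : Type*} (X : Finset ι) (u : ι → ℤ) (hu : Set.InjOn u X) {K : ℕ}
    (hK : ∀ x ∈ X, |u x| ≤ K) : X.card ≤ 2 * K + 1 := by
  have hmaps : Set.MapsTo u X (Finset.Icc (-(K : ℤ)) K) := by
    intro x hx
    simpa [abs_le] using hK x hx
  have := Finset.card_le_card_of_injOn u hmaps hu
  simp at this
  omega

/-- Fibered form: `X` is fibered over the integer pairs `(a, b)`, the values of `h` are separated
along `u` on each fiber, with a separation depending on `b` only. -/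
theorem sum_fibered_le {ι : Type*} (X : Finset ι) (a b u : ι → ℤ) (h w : ι → ℝ) (W η : ℤ → ℝ)
    {K : ℕ} {B : ℝ} (hW : ∀ y, 0 ≤ W y) (hη : ∀ y, 0 < η y)
    (ha : ∀ x ∈ X, |a x| ≤ K) (hb : ∀ x ∈ X, |b x| ≤ K) (hu : ∀ x ∈ X, |u x| ≤ K)
    (hinj : ∀ x ∈ X, ∀ y ∈ X, a x = a y → b x = b y → u x = u y → x = y)
    (hw : ∀ x ∈ X, w x ≤ W (a x))
    (hsep : ∀ x ∈ X, ∀ y ∈ X, a x = a y → b x = b y →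
      η (b x) * |(u x : ℝ) - u y| ≤ |h x - h y|)
    (hB : ∀ Y : Finset ℤ, Y.card ≤ 2 * K + 1 → ∑ y ∈ Y, (1 + |(y : ℝ)|)⁻¹ ≤ B) :
    ∑ x ∈ X, w x * (1 + |h x|)⁻¹ ≤
      (∑ y ∈ Finset.Icc (-(K : ℤ)) K, W y) *
        (∑ y ∈ Finset.Icc (-(K : ℤ)) K, (1 + 2 / η y)) * B := by
  classical
  have hmaps : ∀ x ∈ X, (a x, b x) ∈ Finset.Icc (-(K : ℤ)) K ×ˢ Finset.Icc (-(K : ℤ)) K := by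
    intro x hx
    simpa [abs_le] using And.intro (abs_le.mp (ha x hx)) (abs_le.mp (hb x hx))
  rw [← Finset.sum_fiberwise_of_maps_to hmaps, Finset.sum_mul_sum, ← Finset.sum_product',
    Finset.sum_mul]
  refine Finset.sum_le_sum fun y _ => ?_
  set Xy := X.filter (fun x => (a x, b x) = y) with hXy
  have hmem : ∀ x ∈ Xy, x ∈ X ∧ a x = y.1 ∧ b x = y.2 := by
    intro x hx
    obtain ⟨h1, h2⟩ := Finset.mem_filter.mp hx
    exact ⟨h1, by rw [← h2], by rw [← h2]⟩
  have huinj : Set.InjOn u Xy := by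
    intro x hx x' hx' hxx
    obtain ⟨h1, h2, h3⟩ := hmem x hx
    obtain ⟨h1', h2', h3'⟩ := hmem x' hx'
    exact hinj x h1 x' h1' (h2.trans h2'.symm) (h3.trans h3'.symm) hxx
  have hcard : Xy.card ≤ 2 * K + 1 :=
    card_le_of_injOn_int Xy u huinj fun x hx => hu x (hmem x hx).1
  have hfib := sum_inv_one_add_abs_le_of_separated Xy u huinj h (hη y.2)
    (fun x hx x' hx' => by
      obtain ⟨h1, h2, h3⟩ := hmem x hx
      obtain ⟨h1', h2', h3'⟩ := hmem x' hx'
      rw [← h3]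
      exact hsep x h1 x' h1' (h2.trans h2'.symm) (h3.trans h3'.symm))
    (fun Y hY => hB Y (hY.trans hcard))
  calc ∑ x ∈ Xy, w x * (1 + |h x|)⁻¹ ≤ ∑ x ∈ Xy, W y.1 * (1 + |h x|)⁻¹ := by
        refine Finset.sum_le_sum fun x hx => ?_
        obtain ⟨h1, h2, -⟩ := hmem x hx
        have := hw x h1
        rw [h2] at this
        gcongr
    _ = W y.1 * ∑ x ∈ Xy, (1 + |h x|)⁻¹ := by rw [Finset.mul_sum]
    _ ≤ W y.1 * ((1 + 2 / η y.2) * B) := by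
        have := hW y.1
        gcongr
    _ = _ := by ring

end counting

section lattice

/-- A lattice point as an element of Euclidean space. -/
def emb (n : Fin 3 → ℤ) : EuclideanSpace ℝ (Fin 3) := WithLp.toLp 2 fun i => (n i : ℝ)

theorem emb_apply (n : Fin 3 → ℤ) (i : Fin 3) : emb n i = n i := rfl

theorem emb_add (m n : Fin 3 → ℤ) : emb (m + n) = emb m + emb n := by
  ext i; simp [emb_apply]

theorem norm_emb (n : Fin 3 → ℤ) : ‖emb n‖ = znorm n := by
  simp [EuclideanSpace.norm_eq, znorm, emb_apply]

theorem norm_emb_sq (n : Fin 3 → ℤ) : ‖emb n‖ ^ 2 = ∑ i, (n i : ℝ) ^ 2 := by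
  simp [EuclideanSpace.norm_sq_eq, emb_apply]

theorem abs_apply_le_norm_emb (n : Fin 3 → ℤ) (i : Fin 3) : |(n i : ℝ)| ≤ ‖emb n‖ := by
  simpa [emb_apply] using PiLp.norm_apply_le (emb n) i

theorem one_le_norm_emb {n : Fin 3 → ℤ} (hn : n ≠ 0) : 1 ≤ ‖emb n‖ := by
  obtain ⟨i, hi⟩ := Function.ne_iff.mp hn
  refine le_trans ?_ (abs_apply_le_norm_emb n i)
  exact_mod_cast Int.one_le_abs hi

theorem jb_eq (n : Fin 3 → ℤ) : jb n = Real.sqrt (1 + ‖emb n‖ ^ 2) := by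
  rw [norm_emb_sq]; rfl

theorem one_le_jb (n : Fin 3 → ℤ) : 1 ≤ jb n := by
  rw [jb_eq]; exact Real.one_le_sqrt.mpr (by nlinarith [norm_nonneg (emb n)])

theorem norm_emb_le_jb (n : Fin 3 → ℤ) : ‖emb n‖ ≤ jb n := by
  rw [jb_eq]; exact Real.le_sqrt_of_sq_le (by linarith)

theorem jb_le_one_add (n : Fin 3 → ℤ) : jb n ≤ 1 + ‖emb n‖ := by
  rw [jb_eq]
  exact Real.sqrt_le_iff.mpr ⟨by positivity, by nlinarith [norm_nonneg (emb n)]⟩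

theorem jb_le_two_mul {m n : Fin 3 → ℤ} (h : ‖emb m‖ ≤ 2 * ‖emb n‖) : jb m ≤ 2 * jb n := by
  have h1 : jb n ^ 2 = 1 + ‖emb n‖ ^ 2 := by rw [jb_eq, Real.sq_sqrt (by positivity)]
  have h2 := one_le_jb n
  rw [jb_eq m]
  exact Real.sqrt_le_iff.mpr ⟨by positivity, by nlinarith [norm_nonneg (emb m)]⟩

/-- Finitely many lattice directions suffice to approximate every direction. -/
theorem exists_finset_directions {δ : ℝ} (hδ : 0 < δ) :
    ∃ V : Finset (Fin 3 → ℤ), (∀ v ∈ V, v ≠ 0) ∧ ∀ z : EuclideanSpace ℝ (Fin 3), z ≠ 0 →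
      ∃ v ∈ V, (1 - δ / 2) * (‖emb v‖ * ‖z‖) ≤ inner ℝ (emb v) z := by
  obtain ⟨Q, hQ⟩ := exists_nat_ge (4 / δ + 2)
  have hQ2 : (2 : ℝ) ≤ Q := by
    have : 0 < 4 / δ := by positivity
    linarith
  refine ⟨(Fintype.piFinset fun _ => Finset.Icc (-(Q + 1 : ℤ)) (Q + 1)).filter (· ≠ 0),
    fun v hv => (Finset.mem_filter.mp hv).2, fun z hz => ?_⟩
  have hz0 : 0 < ‖z‖ := norm_pos_iff.mpr hz
  set v : Fin 3 → ℤ := fun i => round (Q * z i / ‖z‖) with hv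
  set e := emb v - (Q / ‖z‖) • z with he
  have hei : ∀ i, |e i| ≤ 1 / 2 := by
    intro i
    have := abs_sub_round (Q * z i / ‖z‖)
    rw [abs_sub_comm] at this
    have heq : e i = round (Q * z i / ‖z‖) - Q * z i / ‖z‖ := by
      change (round (Q * z i / ‖z‖) : ℝ) - Q / ‖z‖ * z i = _
      ring
    rwa [heq]
  have he1 : ‖e‖ ≤ 1 := by
    rw [EuclideanSpace.norm_eq, Real.sqrt_le_iff, and_iff_right zero_le_one, one_pow]
    have : ∀ i, ‖e i‖ ^ 2 ≤ 1 / 4 := by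
      intro i
      rw [Real.norm_eq_abs]
      nlinarith [hei i, abs_nonneg (e i)]
    calc ∑ i, ‖e i‖ ^ 2 ≤ ∑ _i : Fin 3, (1 / 4 : ℝ) := Finset.sum_le_sum fun i _ => this i
      _ ≤ 1 := by simp; norm_num
  have hve : emb v = (Q / ‖z‖) • z + e := by rw [he]; abel
  have hQz : ‖((Q : ℝ) / ‖z‖) • z‖ = Q := by
    rw [norm_smul, Real.norm_of_nonneg (by positivity)]; field_simp
  have hnv : ‖emb v‖ ≤ Q + 1 := by
    rw [hve]; refine (norm_add_le _ _).trans ?_; rw [hQz]; linarith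
  have hnv' : (Q : ℝ) - 1 ≤ ‖emb v‖ := by
    have := norm_sub_le (emb v) e
    rw [hve, add_sub_cancel_right, hQz, ← hve] at this
    linarith
  have hin : (Q - 1) * ‖z‖ ≤ inner ℝ (emb v) z := by
    rw [hve, inner_add_left, real_inner_smul_left, real_inner_self_eq_norm_sq]
    have h1 := (abs_le.mp (abs_real_inner_le_norm e z)).1
    have h2 : ‖e‖ * ‖z‖ ≤ 1 * ‖z‖ := by gcongr
    have h3 : (Q : ℝ) / ‖z‖ * ‖z‖ ^ 2 = Q * ‖z‖ := by field_simp
    linarith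
  refine ⟨v, ?_, ?_⟩
  · refine Finset.mem_filter.mpr ⟨Fintype.mem_piFinset.mpr fun i => ?_, ?_⟩
    · have := (abs_apply_le_norm_emb v i).trans hnv
      rw [Finset.mem_Icc]
      rw [abs_le] at this
      exact ⟨by exact_mod_cast this.1, by exact_mod_cast this.2⟩
    · intro h0
      have : emb v = 0 := by rw [h0]; ext i; simp [emb_apply]
      rw [this, norm_zero] at hnv'
      linarith
  · refine le_trans ?_ hin
    have h4 : 4 ≤ δ * (Q - 2) := by
      have : 4 / δ ≤ Q - 2 := by linarith
      rwa [div_le_iff₀' hδ] at this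
    rcases le_total (1 - δ / 2) 0 with h | h
    · have : 0 ≤ ‖emb v‖ * ‖z‖ := by positivity
      have : 0 ≤ (Q - 1) * ‖z‖ := mul_nonneg (by linarith) hz0.le
      nlinarith
    · have h5 : (1 - δ / 2) * (‖emb v‖ * ‖z‖) ≤ (1 - δ / 2) * ((Q + 1) * ‖z‖) := by gcongr
      have h6 : (1 - δ / 2) * (Q + 1) ≤ Q - 1 := by nlinarith
      nlinarith

/-- The resonance function with `|x| ^ α` in place of the modified bracket. -/
def phase (α σ : ℝ) (m n : Fin 3 → ℤ) : ℝ := ‖emb (m + n)‖ ^ α - σ * ‖emb n‖ ^ α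

/-- The difference vector between the two gradient base points of `phase`. -/
def gap (σ : ℝ) (m n : Fin 3 → ℤ) : EuclideanSpace ℝ (Fin 3) := emb m + (1 - σ) • emb n

/-- A linear functional that is constant along the direction `v`. -/
def cross (v : Fin 3 → ℤ) (i j : Fin 3) (n : Fin 3 → ℤ) : ℤ := n j * v i - n i * v j

theorem abs_phase_sub_ge {α : ℝ} (hα₁ : 1 < α) (hα₂ : α ≤ 2) {σ : ℝ} (hσ : σ = 1 ∨ σ = -1)
    {m v x y : Fin 3 → ℤ} {i j k : Fin 3} (hijk : ∀ l, l = i ∨ l = j ∨ l = k) (hvi : v i ≠ 0)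
    {R ζ : ℝ} (hR : 0 < R) (hζ : 0 ≤ ζ)
    (hx : ‖emb x‖ ≤ R) (hy : ‖emb y‖ ≤ R) (hmx : ‖emb (m + x)‖ ≤ R) (hmy : ‖emb (m + y)‖ ≤ R)
    (hzx : ζ ≤ ‖gap σ m x‖) (hzy : ζ ≤ ‖gap σ m y‖)
    (hvx : (1 - (α - 1) / 2) * (‖emb v‖ * ‖gap σ m x‖) ≤ inner ℝ (emb v) (gap σ m x))
    (hvy : (1 - (α - 1) / 2) * (‖emb v‖ * ‖gap σ m y‖) ≤ inner ℝ (emb v) (gap σ m y))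
    (hj : cross v i j x = cross v i j y) (hk : cross v i k x = cross v i k y) :
    (α - 1) / 4 * R ^ (α - 2) * ζ * |(x i : ℝ) - y i| ≤ |phase α σ m x - phase α σ m y| := by
  have hvi' : (v i : ℝ) ≠ 0 := by exact_mod_cast hvi
  wlog hs : 0 ≤ ((x i : ℝ) - y i) / v i generalizing x y with H
  · rw [abs_sub_comm (x i : ℝ), abs_sub_comm (phase _ _ _ _)]
    refine H hy hx hmy hmx hzy hzx hvy hvx hj.symm hk.symm ?_
    have : ((y i : ℝ) - x i) / v i = -(((x i : ℝ) - y i) / v i) := by ring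
    rw [this]
    linarith
  set s := ((x i : ℝ) - y i) / v i with hsdef
  have hsv : s * v i = (x i : ℝ) - y i := div_mul_cancel₀ _ hvi'
  have hline : ∀ l, cross v i l x = cross v i l y → (x l : ℝ) = y l + s * v l := by
    intro l hl
    have hl' : (x l * v i - x i * v l : ℝ) = y l * v i - y i * v l := by exact_mod_cast hl
    refine mul_right_cancel₀ hvi' ?_
    linear_combination hl' - (v l : ℝ) * hsv
  have hxy : emb x = emb y + s • emb v := by
    ext l
    rcases hijk l with rfl | rfl | rfl
    · simp [emb_apply]; linarith
    · simpa [emb_apply] using hline _ hj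
    · simpa [emb_apply] using hline _ hk
  have hσ1 : |σ| = 1 := by rcases hσ with rfl | rfl <;> simp
  have hσn : ∀ w : EuclideanSpace ℝ (Fin 3), ‖σ • w‖ = ‖w‖ := by
    intro w; rw [norm_smul, Real.norm_eq_abs, hσ1, one_mul]
  have e1 : emb (m + y) + s • emb v = emb (m + x) := by rw [emb_add, emb_add, hxy]; abel
  have e2 : σ • emb y + (σ * s) • emb v = σ • emb x := by rw [hxy]; module
  have e3 : emb (m + y) - σ • emb y = gap σ m y := by rw [emb_add, gap]; module
  have e4 : gap σ m y + ((1 - σ) * s) • emb v = gap σ m x := by rw [gap, gap, hxy]; module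
  have hmain := norm_rpow_sub_increment_ge hα₁ hα₂ hσ (p := emb (m + y)) (q := σ • emb y)
    (v := emb v) (R := R) (ζ := ζ) hs hmy (by rwa [hσn]) (by rwa [e1]) (by rwa [e2, hσn]) hR hζ
    (by rwa [e3]) (by rwa [e3, e4]) (by rwa [e3]) (by rwa [e3, e4])
  rw [e1, e2, hσn, hσn] at hmain
  refine le_trans ?_ (hmain.trans (le_abs_self _))
  have hRp : 0 < R ^ (α - 2) := Real.rpow_pos_of_pos hR _
  have hδ : 0 < α - 1 := by linarith
  have hd : |(x i : ℝ) - y i| ≤ ‖emb v‖ * s := by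
    rw [← hsv, abs_mul, abs_of_nonneg hs, mul_comm]
    gcongr
    exact abs_apply_le_norm_emb v i
  calc (α - 1) / 4 * R ^ (α - 2) * ζ * |(x i : ℝ) - y i|
      ≤ (α - 1) / 4 * R ^ (α - 2) * ζ * (‖emb v‖ * s) := by gcongr
    _ = _ := by ring

theorem eq_of_cross_eq {v x y : Fin 3 → ℤ} {i j k : Fin 3} (hijk : ∀ l, l = i ∨ l = j ∨ l = k)
    (hvi : v i ≠ 0) (hj : cross v i j x = cross v i j y) (hk : cross v i k x = cross v i k y)
    (hi : x i = y i) : x = y := by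
  have hline : ∀ l, cross v i l x = cross v i l y → x l = y l := by
    intro l hl
    simp only [cross, hi] at hl
    exact mul_right_cancel₀ hvi (by linarith)
  funext l
  rcases hijk l with rfl | rfl | rfl
  exacts [hi, hline _ hj, hline _ hk]

theorem abs_cross_le {v : Fin 3 → ℤ} {A : ℝ} (hA : ∀ l, |(v l : ℝ)| ≤ A) (i j : Fin 3)
    (n : Fin 3 → ℤ) : |(cross v i j n : ℝ)| ≤ 2 * A * ‖emb n‖ := by
  have h1 : |(n j * v i : ℝ)| ≤ ‖emb n‖ * A := by
    rw [abs_mul]; exact mul_le_mul (abs_apply_le_norm_emb n j) (hA i) (abs_nonneg _) (norm_nonneg _)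
  have h2 : |(n i * v j : ℝ)| ≤ ‖emb n‖ * A := by
    rw [abs_mul]; exact mul_le_mul (abs_apply_le_norm_emb n i) (hA j) (abs_nonneg _) (norm_nonneg _)
  have h3 := abs_sub (n j * v i : ℝ) (n i * v j)
  push_cast [cross]
  linarith

theorem sum_cone_le {α : ℝ} (hα₁ : 1 < α) (hα₂ : α ≤ 2) {σ : ℝ} (hσ : σ = 1 ∨ σ = -1)
    {m v : Fin 3 → ℤ} {i j k : Fin 3} (hijk : ∀ l, l = i ∨ l = j ∨ l = k) (hvi : v i ≠ 0)
    {A N R B c : ℝ} {K : ℕ} (hA1 : 1 ≤ A) (hA : ∀ l, |(v l : ℝ)| ≤ A) (hR : 0 < R)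
    (hK : 2 * A * N ≤ K) (W Z : ℤ → ℝ) (hW : ∀ y, 0 ≤ W y) (hZ : ∀ y, 0 < Z y)
    (w : (Fin 3 → ℤ) → ℝ) (X : Finset (Fin 3 → ℤ))
    (hXN : ∀ n ∈ X, ‖emb n‖ ≤ N) (hXR : ∀ n ∈ X, ‖emb n‖ ≤ R)
    (hXR' : ∀ n ∈ X, ‖emb (m + n)‖ ≤ R)
    (hcone : ∀ n ∈ X,
      (1 - (α - 1) / 2) * (‖emb v‖ * ‖gap σ m n‖) ≤ inner ℝ (emb v) (gap σ m n))
    (hXZ : ∀ n ∈ X, Z (cross v i k n) ≤ ‖gap σ m n‖)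
    (hXW : ∀ n ∈ X, w n ≤ W (cross v i j n))
    (hB : ∀ Y : Finset ℤ, Y.card ≤ 2 * K + 1 → ∑ y ∈ Y, (1 + |(y : ℝ)|)⁻¹ ≤ B) :
    ∑ n ∈ X, w n * (1 + |phase α σ m n + c|)⁻¹ ≤
      (∑ y ∈ Finset.Icc (-(K : ℤ)) K, W y) *
        (∑ y ∈ Finset.Icc (-(K : ℤ)) K, (1 + 8 / (α - 1) * (R ^ (2 - α) / Z y))) * B := by
  have hRp : 0 < R ^ (α - 2) := Real.rpow_pos_of_pos hR _
  have hδ : 0 < α - 1 := by linarith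
  have hcross : ∀ l, ∀ n ∈ X, |cross v i l n| ≤ (K : ℤ) := by
    intro l n hn
    have h1 := abs_cross_le hA i l n
    have h2 : 2 * A * ‖emb n‖ ≤ 2 * A * N := by have := hXN n hn; gcongr
    exact_mod_cast h1.trans (h2.trans hK)
  have hbase := sum_fibered_le X (cross v i j) (cross v i k) (fun n => n i)
    (fun n => phase α σ m n + c) w W (fun y => (α - 1) / 4 * R ^ (α - 2) * Z y) (K := K) (B := B)
    hW (fun y => by have := hZ y; positivity) (hcross j) (hcross k)
    (fun n hn => by
      have h1 := (abs_apply_le_norm_emb n i).trans (hXN n hn)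
      have h0 : 0 ≤ N := (norm_nonneg _).trans (hXN n hn)
      have h2 : |(n i : ℝ)| ≤ K := by nlinarith
      exact_mod_cast h2)
    (fun x _ y _ hj hk hi => eq_of_cross_eq hijk hvi hj hk hi) hXW
    (fun x hx y hy hj hk => by
      rw [add_sub_add_right_eq_sub]
      exact abs_phase_sub_ge hα₁ hα₂ hσ hijk hvi hR (hZ _).le (hXR x hx) (hXR y hy)
        (hXR' x hx) (hXR' y hy) (hXZ x hx) (hk ▸ hXZ y hy) (hcone x hx) (hcone y hy) hj hk) hB
  refine hbase.trans (le_of_eq ?_)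
  congr 2
  refine Finset.sum_congr rfl fun y _ => ?_
  have h1 : R ^ (2 - α) = (R ^ (α - 2))⁻¹ := by rw [← Real.rpow_neg hR.le]; congr 1; ring
  have := (hZ y).ne'
  rw [h1]
  field_simp
  norm_num

end lattice

section assembly

theorem sum_Icc_inv_one_add_abs_le {K : ℕ} {B : ℝ}
    (hB : ∀ Y : Finset ℤ, Y.card ≤ 2 * K + 1 → ∑ y ∈ Y, (1 + |(y : ℝ)|)⁻¹ ≤ B)
    {c : ℤ} (hc : c ≠ 0) (d : ℤ) :
    ∑ y ∈ Finset.Icc (-(K : ℤ)) K, (1 + |((c * y + d : ℤ) : ℝ)|)⁻¹ ≤ B := by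
  have hinj : Set.InjOn (fun y : ℤ => c * y + d) (Finset.Icc (-(K : ℤ)) K) := by
    intro x _ y _ hxy
    exact mul_left_cancel₀ hc (by simpa using hxy)
  have h := hB ((Finset.Icc (-(K : ℤ)) K).image fun y => c * y + d)
    (Finset.card_image_le.trans (by simp; omega))
  rwa [Finset.sum_image hinj] at h

theorem sum_Icc_const (K : ℕ) (x : ℝ) :
    ∑ _y ∈ Finset.Icc (-(K : ℤ)) K, x = (2 * K + 1) * x := by
  rw [Finset.sum_const, nsmul_eq_mul, Int.card_Icc]
  congr 1
  have : ((K : ℤ) + 1 - -(K : ℤ)).toNat = 2 * K + 1 := by omega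
  rw [this]; push_cast; ring

theorem cross_add (v : Fin 3 → ℤ) (i j : Fin 3) (m n : Fin 3 → ℤ) :
    cross v i j (m + n) = cross v i j m + cross v i j n := by
  simp only [cross, Pi.add_apply]; ring

theorem gap_neg_one (m n : Fin 3 → ℤ) : gap (-1) m n = emb (m + (n + n)) := by
  rw [gap, emb_add, emb_add]; module

theorem gap_one (m n : Fin 3 → ℤ) : gap 1 m n = emb m := by simp [gap]

theorem emb_zero : emb 0 = 0 := by ext i; simp [emb_apply]

/-- Weighted sum over frequencies whose gap vector lies in a fixed cone. -/
theorem sum_cone_weighted_le {α : ℝ} (hα₁ : 1 < α) (hα₂ : α ≤ 2) {σ : ℝ} (hσ : σ = 1 ∨ σ = -1)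
    {m v : Fin 3 → ℤ} {i j k : Fin 3} (hijk : ∀ l, l = i ∨ l = j ∨ l = k) (hvi : v i ≠ 0)
    {A N B c : ℝ} {K : ℕ} (hA1 : 1 ≤ A) (hA : ∀ l, |(v l : ℝ)| ≤ A) (hN : 1 ≤ N)
    (hK : 2 * A * N ≤ K) (hK' : 2 * (K : ℝ) + 1 ≤ 7 * A * N) (hB1 : 1 ≤ B)
    (X : Finset (Fin 3 → ℤ)) (hXN : ∀ n ∈ X, ‖emb n‖ ≤ N)
    (hcone : ∀ n ∈ X,
      (1 - (α - 1) / 2) * (‖emb v‖ * ‖gap σ m n‖) ≤ inner ℝ (emb v) (gap σ m n))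
    (hgap : ∀ n ∈ X, gap σ m n ≠ 0)
    (hB : ∀ Y : Finset ℤ, Y.card ≤ 2 * K + 1 → ∑ y ∈ Y, (1 + |(y : ℝ)|)⁻¹ ≤ B) :
    ∑ n ∈ X, jb m ^ α * jb (m + n) ^ (-α) * (1 + |phase α σ m n + c|)⁻¹ ≤
      784 * A ^ 2 * (1 + 8 / (α - 1)) * (N * (5 * N) ^ α * B ^ 3) := by
  have hδ : 0 < α - 1 := by linarith
  set D := 8 / (α - 1) with hD
  have hD0 : 0 < D := by positivity
  have hmn : ∀ n ∈ X, ‖emb (m + n)‖ ≤ ‖emb m‖ + N := by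
    intro n hn
    rw [emb_add]
    exact (norm_add_le _ _).trans (by have := hXN n hn; linarith)
  have hjm := one_le_jb m
  have h5N : 5 * N ≤ (5 * N) ^ α := by
    calc 5 * N = (5 * N) ^ (1 : ℝ) := (Real.rpow_one _).symm
      _ ≤ _ := Real.rpow_le_rpow_of_exponent_le (by linarith) hα₁.le
  have hBpow : B ≤ B ^ 3 := le_self_pow₀ hB1 (by norm_num)
  have hBpow2 : B ^ 2 ≤ B ^ 3 := pow_le_pow_right₀ hB1 (by norm_num)
  rcases lt_or_ge (4 * N) ‖emb m‖ with hfar | hnear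
  · -- the frequency `m` dominates
    have hm0 : 0 < ‖emb m‖ := by linarith
    have hmain := sum_cone_le hα₁ hα₂ hσ hijk hvi (c := c) hA1 hA
      (by positivity : 0 < 2 * ‖emb m‖) hK
      (fun _ => 4) (fun _ => ‖emb m‖ / 2) (fun _ => by norm_num) (fun _ => by positivity)
      (fun n => jb m ^ α * jb (m + n) ^ (-α)) X hXN
      (fun n hn => by have := hXN n hn; linarith)
      (fun n hn => by have := hmn n hn; linarith) hcone
      (fun n hn => by
        have h1 := hXN n hn
        have h2 : ‖(1 - σ) • emb n‖ ≤ 2 * N := by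
          rw [norm_smul]
          refine mul_le_mul ?_ h1 (norm_nonneg _) (by norm_num)
          rcases hσ with rfl | rfl <;> norm_num
        have h3 := norm_sub_le (gap σ m n) ((1 - σ) • emb n)
        rw [gap, add_sub_cancel_right] at h3
        rw [gap]
        linarith)
      (fun n hn => by
        have h1 : ‖emb m‖ ≤ 2 * ‖emb (m + n)‖ := by
          have h3 := norm_sub_le (emb (m + n)) (emb n)
          rw [emb_add, add_sub_cancel_right, ← emb_add] at h3
          have := hXN n hn
          linarith
        have h2 := jb_le_two_mul h1
        have hj := one_le_jb (m + n)
        have h4 : (2 : ℝ) ^ α ≤ 4 := by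
          calc (2 : ℝ) ^ α ≤ 2 ^ (2 : ℝ) :=
                Real.rpow_le_rpow_of_exponent_le (by norm_num) hα₂
            _ = 4 := by norm_num
        calc jb m ^ α * jb (m + n) ^ (-α) ≤ (2 * jb (m + n)) ^ α * jb (m + n) ^ (-α) := by
              gcongr
          _ = 2 ^ α := by
              rw [Real.mul_rpow (by norm_num) (by linarith), mul_assoc,
                ← Real.rpow_add (by linarith)]
              simp
          _ ≤ 4 := h4) hB
    refine hmain.trans ?_
    rw [sum_Icc_const, sum_Icc_const]
    have hratio : (2 * ‖emb m‖) ^ (2 - α) / (‖emb m‖ / 2) ≤ 4 := by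
      rw [div_le_iff₀ (by positivity)]
      calc (2 * ‖emb m‖) ^ (2 - α) ≤ (2 * ‖emb m‖) ^ (1 : ℝ) :=
            Real.rpow_le_rpow_of_exponent_le (by linarith) (by linarith)
        _ = 4 * (‖emb m‖ / 2) := by rw [Real.rpow_one]; ring
    calc (2 * (K : ℝ) + 1) * 4 *
          ((2 * K + 1) * (1 + D * ((2 * ‖emb m‖) ^ (2 - α) / (‖emb m‖ / 2)))) * B
        ≤ (7 * A * N) * 4 * ((7 * A * N) * (1 + D * 4)) * B := by gcongr
      _ ≤ (7 * A * N) * 4 * ((7 * A * (5 * N) ^ α) * (4 * (1 + D))) * B ^ 3 := by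
          gcongr
          · linarith
          · linarith
      _ = _ := by ring
  -- both frequencies are controlled by `N`
  have hjm5 : jb m ≤ 5 * N := by have := jb_le_one_add m; linarith
  have hjmα : jb m ^ α ≤ (5 * N) ^ α := by gcongr
  have hXR : ∀ n ∈ X, ‖emb n‖ ≤ 5 * N := fun n hn => by have := hXN n hn; linarith
  have hXR' : ∀ n ∈ X, ‖emb (m + n)‖ ≤ 5 * N := fun n hn => by have := hmn n hn; linarith
  set W : ℤ → ℝ := fun y => jb m ^ α * (4 * A) * (1 + |((1 * y + cross v i j m : ℤ) : ℝ)|)⁻¹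
    with hWdef
  have hW0 : ∀ y, 0 ≤ W y := fun y => by positivity
  have hXW : ∀ n ∈ X, jb m ^ α * jb (m + n) ^ (-α) ≤ W (cross v i j n) := by
    intro n _
    have hj := one_le_jb (m + n)
    have hcr := abs_cross_le hA i j (m + n)
    have heq : 1 * cross v i j n + cross v i j m = cross v i j (m + n) := by
      rw [cross_add]; ring
    simp only [hWdef, heq, mul_assoc]
    have h1 : jb (m + n) ^ (-α) ≤ (jb (m + n))⁻¹ := by
      rw [← Real.rpow_neg_one]
      exact Real.rpow_le_rpow_of_exponent_le hj (by linarith)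
    have h2 : (jb (m + n))⁻¹ ≤ 4 * A * (1 + |(cross v i j (m + n) : ℝ)|)⁻¹ := by
      rw [← div_eq_mul_inv, inv_eq_one_div, div_le_div_iff₀ (by linarith) (by positivity)]
      have h3 := norm_emb_le_jb (m + n)
      nlinarith
    rw [← mul_assoc 4 A]
    gcongr
    exact h1.trans h2
  have hWsum : ∑ y ∈ Finset.Icc (-(K : ℤ)) K, W y ≤ jb m ^ α * (4 * A) * B := by
    rw [hWdef, ← Finset.mul_sum]
    gcongr
    exact sum_Icc_inv_one_add_abs_le hB one_ne_zero _
  rcases hσ with rfl | rfl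
  · rcases X.eq_empty_or_nonempty with rfl | ⟨n₀, hn₀⟩
    · simp only [Finset.sum_empty]
      positivity
    have hm : m ≠ 0 := by
      rintro rfl
      exact hgap n₀ hn₀ (by rw [gap_one, emb_zero])
    have hm1 := one_le_norm_emb hm
    have hmain := sum_cone_le hα₁ hα₂ (Or.inl rfl) hijk hvi (c := c) hA1 hA
      (by positivity : 0 < 5 * N) hK W (fun _ => ‖emb m‖) hW0 (fun _ => by linarith)
      (fun n => jb m ^ α * jb (m + n) ^ (-α)) X hXN hXR hXR' hcone
      (fun n _ => by rw [gap_one]) hXW hB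
    refine hmain.trans ?_
    rw [sum_Icc_const]
    have hjm2 : jb m ≤ 2 * ‖emb m‖ := by have := jb_le_one_add m; linarith
    have hratio : jb m ^ α * ((5 * N) ^ (2 - α) / ‖emb m‖) ≤ 2 * (5 * N) ^ α := by
      rw [mul_div_assoc', div_le_iff₀ (by linarith)]
      calc jb m ^ α * (5 * N) ^ (2 - α)
          = jb m ^ (α - 1) * jb m * (5 * N) ^ (2 - α) := by
            rw [← Real.rpow_add_one (by linarith)]; congr 2; ring
        _ ≤ (5 * N) ^ (α - 1) * (2 * ‖emb m‖) * (5 * N) ^ (2 - α) := by gcongr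
        _ = (5 * N) ^ (1 : ℝ) * (2 * ‖emb m‖) := by
            rw [mul_right_comm, ← Real.rpow_add (by linarith)]; congr 2; ring
        _ ≤ (5 * N) ^ α * (2 * ‖emb m‖) := by rw [Real.rpow_one]; gcongr
        _ = _ := by ring
    calc (∑ y ∈ Finset.Icc (-(K : ℤ)) K, W y) *
          ((2 * (K : ℝ) + 1) * (1 + D * ((5 * N) ^ (2 - α) / ‖emb m‖))) * B
        ≤ (jb m ^ α * (4 * A) * B) *
          ((7 * A * N) * (1 + D * ((5 * N) ^ (2 - α) / ‖emb m‖))) * B := by gcongr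
      _ = 28 * A ^ 2 * N * B ^ 2 *
          (jb m ^ α + D * (jb m ^ α * ((5 * N) ^ (2 - α) / ‖emb m‖))) := by ring
      _ ≤ 28 * A ^ 2 * N * B ^ 3 * ((5 * N) ^ α + D * (2 * (5 * N) ^ α)) := by gcongr
      _ = 28 * A ^ 2 * (1 + 2 * D) * (N * (5 * N) ^ α * B ^ 3) := by ring
      _ ≤ 784 * A ^ 2 * (1 + D) * (N * (5 * N) ^ α * B ^ 3) := by
          gcongr ?_ * _
          nlinarith [sq_nonneg A, mul_nonneg (sq_nonneg A) hD0.le]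
  · set Z : ℤ → ℝ := fun y => (1 + |((2 * y + cross v i k m : ℤ) : ℝ)|) / (4 * A) with hZdef
    have hmain := sum_cone_le hα₁ hα₂ (Or.inr rfl) hijk hvi (c := c) hA1 hA
      (by positivity : 0 < 5 * N) hK W Z hW0 (fun _ => by positivity)
      (fun n => jb m ^ α * jb (m + n) ^ (-α)) X hXN hXR hXR' hcone
      (fun n hn => by
        have hne := hgap n hn
        rw [gap_neg_one] at hne ⊢
        have h1 : 1 ≤ ‖emb (m + (n + n))‖ :=
          one_le_norm_emb (fun h => hne (by rw [h, emb_zero]))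
        have heq : 2 * cross v i k n + cross v i k m = cross v i k (m + (n + n)) := by
          rw [cross_add, cross_add]; ring
        have hcr := abs_cross_le hA i k (m + (n + n))
        simp only [hZdef, heq]
        rw [div_le_iff₀ (by positivity)]
        nlinarith) hXW hB
    refine hmain.trans ?_
    have hZsum : ∑ y ∈ Finset.Icc (-(K : ℤ)) K, (1 + D * ((5 * N) ^ (2 - α) / Z y)) ≤
        7 * A * N + D * (5 * N) * (4 * A) * B := by
      have hpow : (5 * N) ^ (2 - α) ≤ 5 * N := by
        calc (5 * N) ^ (2 - α) ≤ (5 * N) ^ (1 : ℝ) :=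
              Real.rpow_le_rpow_of_exponent_le (by linarith) (by linarith)
          _ = _ := Real.rpow_one _
      have hs := sum_Icc_inv_one_add_abs_le hB two_ne_zero (cross v i k m)
      calc ∑ y ∈ Finset.Icc (-(K : ℤ)) K, (1 + D * ((5 * N) ^ (2 - α) / Z y))
          = (2 * K + 1) * 1 + D * (5 * N) ^ (2 - α) * (4 * A) *
            ∑ y ∈ Finset.Icc (-(K : ℤ)) K,
              (1 + |((2 * y + cross v i k m : ℤ) : ℝ)|)⁻¹ := by
            rw [Finset.sum_add_distrib, sum_Icc_const, Finset.mul_sum]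
            congr 1
            refine Finset.sum_congr rfl fun y _ => ?_
            simp only [hZdef]
            field_simp
        _ ≤ 7 * A * N + D * (5 * N) * (4 * A) * B := by
            rw [mul_one]
            gcongr
    calc (∑ y ∈ Finset.Icc (-(K : ℤ)) K, W y) *
          (∑ y ∈ Finset.Icc (-(K : ℤ)) K, (1 + D * ((5 * N) ^ (2 - α) / Z y))) * B
        ≤ (jb m ^ α * (4 * A) * B) * (7 * A * N + D * (5 * N) * (4 * A) * B) * B := by
          gcongr
      _ ≤ ((5 * N) ^ α * (4 * A) * B) * (7 * A * N * B + D * (5 * N) * (4 * A) * B) * B := by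
          have h7 : 7 * A * N ≤ 7 * A * N * B := le_mul_of_one_le_right (by positivity) hB1
          gcongr ?_ * (4 * A) * B * ?_ * B
          linarith
      _ = (28 + 80 * D) * A ^ 2 * (N * (5 * N) ^ α * B ^ 3) := by ring
      _ ≤ 784 * A ^ 2 * (1 + D) * (N * (5 * N) ^ α * B ^ 3) := by
          gcongr ?_ * _
          nlinarith [sq_nonneg A, mul_nonneg (sq_nonneg A) hD0.le]

end assembly

section conclusion

theorem exists_sum_cone_weighted_le {α : ℝ} (hα₁ : 1 < α) (hα₂ : α ≤ 2) {v : Fin 3 → ℤ}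
    (hv : v ≠ 0) :
    ∃ C : ℝ, 0 < C ∧ ∀ σ : ℝ, (σ = 1 ∨ σ = -1) → ∀ (m : Fin 3 → ℤ) (c N : ℝ), 1 ≤ N →
      ∀ X : Finset (Fin 3 → ℤ), (∀ n ∈ X, ‖emb n‖ ≤ N) →
      (∀ n ∈ X, (1 - (α - 1) / 2) * (‖emb v‖ * ‖gap σ m n‖) ≤ inner ℝ (emb v) (gap σ m n)) →
      (∀ n ∈ X, gap σ m n ≠ 0) →
      ∑ n ∈ X, jb m ^ α * jb (m + n) ^ (-α) * (1 + |phase α σ m n + c|)⁻¹ ≤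
        C * N ^ (2 * α - (α - 1) / 2) := by
  obtain ⟨i, hi⟩ := Function.ne_iff.mp hv
  have hijk : ∀ i l : Fin 3, l = i ∨ l = i + 1 ∨ l = i + 2 := by decide
  set τ := (α - 1) / 6 with hτ
  have hδ : 0 < α - 1 := by linarith
  have hτ0 : 0 < τ := by positivity
  obtain ⟨CH, hCH, hharm⟩ := exists_sum_inv_one_add_abs_le hτ0
  set A := ‖emb v‖ with hA
  have hA1 : 1 ≤ A := one_le_norm_emb hv
  set H := CH * (7 * A) ^ τ + 1 with hH
  have hH1 : 1 ≤ H := by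
    have : 0 < CH * (7 * A) ^ τ := by positivity
    linarith
  refine ⟨784 * A ^ 2 * (1 + 8 / (α - 1)) * (5 ^ α * H ^ 3), by positivity, ?_⟩
  intro σ hσ m c N hN X hXN hcone hgap
  have hN0 : 0 < N := by linarith
  have hNτ : 1 ≤ N ^ τ := Real.one_le_rpow hN hτ0.le
  have hAN : 1 ≤ A * N := one_le_mul_of_one_le_of_one_le hA1 hN
  have hK' : 2 * (⌈2 * A * N⌉₊ : ℝ) + 1 ≤ 7 * A * N := by
    have := (Nat.ceil_lt_add_one (by positivity : 0 ≤ 2 * A * N)).le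
    linarith
  have hmain := sum_cone_weighted_le hα₁ hα₂ hσ (m := m) (hijk i) hi (N := N) (B := H * N ^ τ) (c := c)
    (K := ⌈2 * A * N⌉₊) hA1 (abs_apply_le_norm_emb v) hN (Nat.le_ceil _) hK'
    (one_le_mul_of_one_le_of_one_le hH1 hNτ) X hXN hcone hgap
    (fun Y hY => by
      have h1 : (Y.card : ℝ) ≤ 7 * A * N := by
        refine le_trans ?_ hK'
        exact_mod_cast hY
      refine (hharm Y (7 * A * N) (by linarith) h1).trans ?_
      rw [Real.mul_rpow (by positivity) hN0.le, ← mul_assoc]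
      gcongr
      linarith)
  refine hmain.trans (le_of_eq ?_)
  have hexp : N ^ (2 * α - (α - 1) / 2) = N * N ^ α * (N ^ τ) ^ 3 := by
    rw [← Real.rpow_natCast, ← Real.rpow_mul hN0.le, mul_comm N, ← Real.rpow_add_one hN0.ne',
      ← Real.rpow_add hN0]
    congr 1
    push_cast
    rw [hτ]
    ring
  rw [hexp, Real.mul_rpow (by norm_num) hN0.le]
  ring

theorem card_le_of_norm_emb_le {X : Finset (Fin 3 → ℤ)} {N : ℝ} (hN : 1 ≤ N)
    (hX : ∀ n ∈ X, ‖emb n‖ ≤ N) : (X.card : ℝ) ≤ 125 * N ^ 3 := by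
  set K := ⌈N⌉₊
  have hsub : X ⊆ Fintype.piFinset fun _ : Fin 3 => Finset.Icc (-(K : ℤ)) K := by
    intro n hn
    refine Fintype.mem_piFinset.mpr fun i => ?_
    have h1 := (abs_apply_le_norm_emb n i).trans ((hX n hn).trans (Nat.le_ceil N))
    rw [Finset.mem_Icc, ← abs_le]
    exact_mod_cast h1
  have hcard := Finset.card_le_card hsub
  have h2 : (Fintype.piFinset fun _ : Fin 3 => Finset.Icc (-(K : ℤ)) K).card =
      (2 * K + 1) ^ 3 := by
    rw [Fintype.card_piFinset_const, Int.card_Icc]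
    congr 1
    omega
  rw [h2] at hcard
  have hK : 2 * (K : ℝ) + 1 ≤ 5 * N := by
    have := (Nat.ceil_lt_add_one (by positivity : 0 ≤ N)).le
    linarith
  calc (X.card : ℝ) ≤ (2 * (K : ℝ) + 1) ^ 3 := by exact_mod_cast hcard
    _ ≤ (5 * N) ^ 3 := by gcongr
    _ = _ := by ring

/-- The weighted sum over the degenerate frequencies, where the gap vector vanishes. -/
theorem sum_degenerate_le {α : ℝ} (hα₁ : 1 < α) (hα₂ : α ≤ 2) {σ : ℝ} (hσ : σ = 1 ∨ σ = -1)
    (m : Fin 3 → ℤ) (c : ℝ) {N : ℝ} (hN : 1 ≤ N) (X : Finset (Fin 3 → ℤ))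
    (hXN : ∀ n ∈ X, ‖emb n‖ ≤ N) (hXN' : ∀ n ∈ X, N ≤ 2 * jb n) (hgap : ∀ n ∈ X, gap σ m n = 0) :
    ∑ n ∈ X, jb m ^ α * jb (m + n) ^ (-α) * (1 + |phase α σ m n + c|)⁻¹ ≤
      500 * N ^ (2 * α - (α - 1) / 2) := by
  have hN0 : 0 < N := by linarith
  have h4 : (2 : ℝ) ^ α ≤ 4 := by
    calc (2 : ℝ) ^ α ≤ 2 ^ (2 : ℝ) := Real.rpow_le_rpow_of_exponent_le (by norm_num) hα₂
      _ = 4 := by norm_num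
  have hemb : ∀ n, emb n = 0 → n = 0 := by
    intro n hn
    by_contra h
    have := one_le_norm_emb h
    rw [hn, norm_zero] at this
    linarith
  have hinv : ∀ n, jb m ^ α * jb (m + n) ^ (-α) * (1 + |phase α σ m n + c|)⁻¹ ≤
      jb m ^ α * jb (m + n) ^ (-α) := by
    intro n
    have := one_le_jb m
    have := one_le_jb (m + n)
    exact mul_le_of_le_one_right (by positivity)
      (inv_le_one_of_one_le₀ (by linarith [abs_nonneg (phase α σ m n + c)]))
  rcases X.eq_empty_or_nonempty with rfl | ⟨n₀, hn₀⟩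
  · simp only [Finset.sum_empty]
    positivity
  rcases hσ with rfl | rfl
  · have hm : m = 0 := hemb m (by rw [← gap_one m n₀]; exact hgap n₀ hn₀)
    subst hm
    have hterm : ∀ n ∈ X, jb 0 ^ α * jb (0 + n) ^ (-α) * (1 + |phase α 1 0 n + c|)⁻¹ ≤
        4 * N ^ (-α) := by
      intro n hn
      refine (hinv n).trans ?_
      have hj0 : jb 0 = 1 := by simp [jb]
      rw [hj0, Real.one_rpow, one_mul, zero_add]
      calc jb n ^ (-α) ≤ (N / 2) ^ (-α) :=
            Real.rpow_le_rpow_of_nonpos (by positivity) (by linarith [hXN' n hn]) (by linarith)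
        _ = 2 ^ α * N ^ (-α) := by
            rw [Real.div_rpow hN0.le (by norm_num), Real.rpow_neg (by norm_num : (0 : ℝ) ≤ 2)]
            field_simp
        _ ≤ 4 * N ^ (-α) := by gcongr
    calc _ ≤ ∑ _n ∈ X, 4 * N ^ (-α) := Finset.sum_le_sum hterm
      _ = X.card * (4 * N ^ (-α)) := by rw [Finset.sum_const, nsmul_eq_mul]
      _ ≤ 125 * N ^ 3 * (4 * N ^ (-α)) := by
          gcongr
          exact card_le_of_norm_emb_le hN hXN
      _ = 500 * N ^ (3 - α) := by
          rw [sub_eq_add_neg, Real.rpow_add hN0, ← Real.rpow_natCast N 3]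
          push_cast
          ring
      _ ≤ _ := mul_le_mul_of_nonneg_left
          (Real.rpow_le_rpow_of_exponent_le hN (by linarith)) (by norm_num)
  · have hz : ∀ n ∈ X, m + (n + n) = 0 := fun n hn =>
      hemb _ (by rw [← gap_neg_one]; exact hgap n hn)
    have hX : X = {n₀} := by
      refine Finset.eq_singleton_iff_unique_mem.mpr ⟨hn₀, fun n hn => ?_⟩
      funext l
      have h1 := congrFun (hz n hn) l
      have h2 := congrFun (hz n₀ hn₀) l
      simp only [Pi.add_apply, Pi.zero_apply] at h1 h2
      omega
    rw [hX, Finset.sum_singleton]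
    refine (hinv n₀).trans ?_
    have hnorm : ‖emb m‖ ≤ 2 * ‖emb (m + n₀)‖ := by
      have h1 : emb m + (emb n₀ + emb n₀) = 0 := by
        rw [← emb_add, ← emb_add, hz n₀ hn₀, emb_zero]
      have h2 : emb m = (2 : ℝ) • emb (m + n₀) := by
        rw [emb_add, eq_neg_of_add_eq_zero_left h1]
        module
      rw [h2, norm_smul]
      norm_num
    have h2 := jb_le_two_mul hnorm
    have hj := one_le_jb (m + n₀)
    have hjm := one_le_jb m
    calc jb m ^ α * jb (m + n₀) ^ (-α) ≤ (2 * jb (m + n₀)) ^ α * jb (m + n₀) ^ (-α) := by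
          gcongr
      _ = 2 ^ α := by
          rw [Real.mul_rpow (by norm_num) (by linarith), mul_assoc, ← Real.rpow_add (by linarith)]
          simp
      _ ≤ 500 * 1 := by linarith
      _ ≤ _ := by
          gcongr
          exact Real.one_le_rpow hN (by linarith)

theorem exists_sum_weighted_le {α : ℝ} (hα₁ : 1 < α) (hα₂ : α ≤ 2) :
    ∃ C : ℝ, 0 < C ∧ ∀ σ : ℝ, (σ = 1 ∨ σ = -1) → ∀ (m : Fin 3 → ℤ) (c N : ℝ), 1 ≤ N →
      ∀ X : Finset (Fin 3 → ℤ), (∀ n ∈ X, ‖emb n‖ ≤ N) → (∀ n ∈ X, N ≤ 2 * jb n) →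
      ∑ n ∈ X, jb m ^ α * jb (m + n) ^ (-α) * (1 + |phase α σ m n + c|)⁻¹ ≤
        C * N ^ (2 * α - (α - 1) / 2) := by
  classical
  obtain ⟨V, hV0, hV⟩ := exists_finset_directions (δ := α - 1) (by linarith)
  choose! C hC0 hC using fun v (hv : v ∈ V) => exists_sum_cone_weighted_le hα₁ hα₂ (hV0 v hv)
  have hCsum : 0 ≤ ∑ v ∈ V, C v := Finset.sum_nonneg fun v hv => (hC0 v hv).le
  refine ⟨∑ v ∈ V, C v + 500, by linarith, ?_⟩
  intro σ hσ m c N hN X hXN hXN'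
  set f : (Fin 3 → ℤ) → ℝ :=
    fun n => jb m ^ α * jb (m + n) ^ (-α) * (1 + |phase α σ m n + c|)⁻¹ with hf
  have hf0 : ∀ n, 0 ≤ f n := by
    intro n
    have := one_le_jb m
    have := one_le_jb (m + n)
    positivity
  have hdeg := sum_degenerate_le hα₁ hα₂ hσ m c hN (X.filter fun n => gap σ m n = 0)
    (fun n hn => hXN n (Finset.mem_filter.mp hn).1)
    (fun n hn => hXN' n (Finset.mem_filter.mp hn).1) (fun n hn => (Finset.mem_filter.mp hn).2)
  set P : (Fin 3 → ℤ) → (Fin 3 → ℤ) → Prop := fun v n =>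
    (1 - (α - 1) / 2) * (‖emb v‖ * ‖gap σ m n‖) ≤ inner ℝ (emb v) (gap σ m n) ∧ gap σ m n ≠ 0
    with hP
  have hcone : ∀ v ∈ V, ∑ n ∈ X.filter (P v), f n ≤ C v * N ^ (2 * α - (α - 1) / 2) :=
    fun v hv => hC v hv σ hσ m c N hN (X.filter (P v))
      (fun n hn => hXN n (Finset.mem_filter.mp hn).1)
      (fun n hn => (Finset.mem_filter.mp hn).2.1) (fun n hn => (Finset.mem_filter.mp hn).2.2)
  have hcover : ∑ n ∈ X.filter (fun n => ¬ gap σ m n = 0), f n ≤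
      ∑ v ∈ V, ∑ n ∈ X.filter (P v), f n := by
    calc ∑ n ∈ X.filter (fun n => ¬ gap σ m n = 0), f n
        ≤ ∑ n ∈ X.filter (fun n => ¬ gap σ m n = 0), ∑ v ∈ V, if P v n then f n else 0 := by
          refine Finset.sum_le_sum fun n hn => ?_
          have hne := (Finset.mem_filter.mp hn).2
          obtain ⟨v, hv, hvn⟩ := hV _ hne
          have hPv : P v n := ⟨hvn, hne⟩
          have := Finset.single_le_sum (f := fun v => if P v n then f n else 0)
            (fun v _ => by
              change 0 ≤ if P v n then f n else 0
              split_ifs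
              exacts [hf0 n, le_rfl]) hv
          simpa only [hPv, if_true] using this
      _ ≤ ∑ n ∈ X, ∑ v ∈ V, if P v n then f n else 0 :=
          Finset.sum_le_sum_of_subset_of_nonneg (Finset.filter_subset _ _) fun n _ _ =>
            Finset.sum_nonneg fun v _ => by
              split_ifs
              exacts [hf0 n, le_rfl]
      _ = _ := by
          rw [Finset.sum_comm]
          exact Finset.sum_congr rfl fun v _ => (Finset.sum_filter _ _).symm
  rw [← Finset.sum_filter_add_sum_filter_not X (fun n => gap σ m n = 0)]
  have hsum := Finset.sum_le_sum hcone
  rw [← Finset.sum_mul] at hsum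
  linarith

theorem half_rpow_jb_le_jbb {α : ℝ} (hα : 0 ≤ α) (n : Fin 3 → ℤ) : jb n ^ α / 2 ≤ jbb α n := by
  have hj := one_le_jb n
  have h1 : 1 ≤ jb n ^ α := Real.one_le_rpow hj hα
  have h2 : jb n ^ (2 * α) = (jb n ^ α) ^ 2 := by
    rw [← Real.rpow_natCast, ← Real.rpow_mul (by linarith), mul_comm]; norm_num
  rw [jbb, h2]
  exact Real.le_sqrt_of_sq_le (by nlinarith)

theorem abs_jbb_sub_le {α : ℝ} (hα₁ : 1 < α) (hα₂ : α ≤ 2) (n : Fin 3 → ℤ) :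
    |jbb α n - ‖emb n‖ ^ α| ≤ 1 := by
  have hj := one_le_jb n
  have h1 : 1 ≤ jb n ^ α := Real.one_le_rpow hj (by linarith)
  have h2 : jb n ^ (2 * α) = (jb n ^ α) ^ 2 := by
    rw [← Real.rpow_natCast, ← Real.rpow_mul (by linarith), mul_comm]; norm_num
  have h3 : ‖emb n‖ ^ α ≤ jb n ^ α :=
    Real.rpow_le_rpow (norm_nonneg _) (norm_emb_le_jb n) (by linarith)
  have h4 : jb n ^ α ≤ 1 + ‖emb n‖ ^ α := by
    have h5 := Real.rpow_add_le_add_rpow zero_le_one (sq_nonneg ‖emb n‖)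
      (by linarith : 0 ≤ α / 2) (by linarith : α / 2 ≤ 1)
    rw [Real.one_rpow, ← Real.rpow_natCast ‖emb n‖, ← Real.rpow_mul (norm_nonneg _)] at h5
    rw [jb_eq, Real.sqrt_eq_rpow, ← Real.rpow_mul (by positivity)]
    convert h5 using 2
    · norm_num
    · ring
    · push_cast; ring_nf
  have h6 : jbb α n ≤ jb n ^ α := by
    rw [jbb, h2]
    exact Real.sqrt_le_iff.mpr ⟨by linarith, by linarith⟩
  have h7 : jb n ^ α - 1 ≤ jbb α n := by
    rw [jbb, h2]
    exact Real.le_sqrt_of_sq_le (by nlinarith)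
  rw [abs_le]
  constructor <;> linarith

theorem ind_nonneg (p : Prop) : 0 ≤ ind p := by
  unfold ind; split_ifs <;> norm_num

theorem sum_ind_abs_sub_le (κ : ℝ) (s : Finset ℤ) :
    ∑ k ∈ s, ind (|κ - (k : ℝ)| ≤ 1) ≤ 3 := by
  classical
  have hsub : s.filter (fun k : ℤ => |κ - (k : ℝ)| ≤ 1) ⊆ Finset.Icc (⌊κ⌋ - 1) (⌊κ⌋ + 1) := by
    intro k hk
    have h := abs_le.mp (Finset.mem_filter.mp hk).2
    have h1 := Int.floor_le κ
    have h2 := Int.lt_floor_add_one κ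
    have h3 : (⌊κ⌋ : ℝ) - 1 ≤ k := by linarith
    have h4 : (k : ℝ) < ⌊κ⌋ + 1 + 1 := by linarith
    rw [Finset.mem_Icc]
    exact ⟨by exact_mod_cast h3, Int.lt_add_one_iff.mp (by exact_mod_cast h4)⟩
  have hcard := Finset.card_le_card hsub
  rw [Int.card_Icc] at hcard
  have h3 : (s.filter (fun k : ℤ => |κ - (k : ℝ)| ≤ 1)).card ≤ 3 := by omega
  calc ∑ k ∈ s, ind (|κ - (k : ℝ)| ≤ 1)
      = ((s.filter (fun k : ℤ => |κ - (k : ℝ)| ≤ 1)).card : ℝ) := by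
        rw [← Finset.sum_boole]
        refine Finset.sum_congr rfl fun k _ => ?_
        unfold ind
        congr
    _ ≤ 3 := by exact_mod_cast h3

theorem inv_rjb_mul_ind_le {κ x y : ℝ} (h : |y| ≤ |κ| + 2) :
    (rjb x)⁻¹ * ind (|κ - x| ≤ 1) ≤ 8 * (1 + |y|)⁻¹ * ind (|κ - x| ≤ 1) := by
  unfold ind
  split_ifs with hκ
  · rw [mul_one, mul_one]
    have h1 : |κ| ≤ |x| + 1 := by
      have := abs_sub_abs_le_abs_sub κ x
      linarith
    have h2 : (1 + |x|) / 2 ≤ rjb x := by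
      refine Real.le_sqrt_of_sq_le ?_
      nlinarith [sq_abs x, sq_nonneg (|x| - 1)]
    have hx := abs_nonneg x
    have h3 : 0 < rjb x := by linarith
    rw [← div_eq_mul_inv, inv_eq_one_div, div_le_div_iff₀ h3 (by positivity)]
    linarith
  · simp

theorem abs_phase_add_le {α : ℝ} (hα₁ : 1 < α) (hα₂ : α ≤ 2) {ε ε' : ℝ} (hε : IsSign ε)
    (hε' : IsSign ε') (m n : Fin 3 → ℤ) (A : ℝ) :
    |phase α (-(ε * ε')) m n + ε * A| ≤ |ε * jbb α (m + n) + A + ε' * jbb α n| + 2 := by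
  have h1 := abs_le.mp (abs_jbb_sub_le hα₁ hα₂ (m + n))
  have h2 := abs_le.mp (abs_jbb_sub_le hα₁ hα₂ n)
  unfold phase
  rcases hε with rfl | rfl <;> rcases hε' with rfl | rfl <;> rw [abs_le] <;>
    constructor <;>
    rcases abs_cases (_ : ℝ) with ⟨h3, h4⟩ | ⟨h3, h4⟩ <;> rw [h3] <;> linarith

theorem SimFreq.bounds {N : ℝ} (hN : 1 ≤ N) {n : Fin 3 → ℤ} (h : SimFreq N n) :
    ‖emb n‖ ≤ N ∧ N ≤ 2 * jb n := by
  have hj := one_le_jb n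
  have hj' := norm_emb_le_jb n
  rw [norm_emb] at hj' ⊢
  rcases h with ⟨_, h2, h3⟩ | ⟨h1, h2⟩
  · exact ⟨h3, by linarith⟩
  · exact ⟨by linarith, by linarith⟩

theorem jbb_pos {α : ℝ} (hα : 0 ≤ α) (n : Fin 3 → ℤ) : 0 < jbb α n := by
  have hj := one_le_jb n
  exact lt_of_lt_of_le (by positivity) (half_rpow_jb_le_jbb hα n)

theorem inv_jbb_le {α : ℝ} (hα : 0 ≤ α) (n : Fin 3 → ℤ) : (jbb α n)⁻¹ ≤ 2 * jb n ^ (-α) := by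
  have hj := one_le_jb n
  have hp : 0 < jb n ^ α := by positivity
  rw [Real.rpow_neg (by linarith)]
  calc (jbb α n)⁻¹ ≤ (jb n ^ α / 2)⁻¹ := inv_anti₀ (by positivity) (half_rpow_jb_le_jbb hα n)
    _ = _ := by rw [inv_div, div_eq_mul_inv]

theorem jbb_rpow_neg_two_le {α : ℝ} (hα₁ : 1 < α) (hα₂ : α ≤ 2) {N : ℝ} (hN : 1 ≤ N)
    {n : Fin 3 → ℤ} (hn : N ≤ 2 * jb n) : jbb α n ^ (-2 : ℝ) ≤ 64 * N ^ (-(2 * α)) := by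
  have hj := one_le_jb n
  have hpos := jbb_pos (by linarith : 0 ≤ α) n
  have h4 : (2 : ℝ) ^ α ≤ 4 := by
    calc (2 : ℝ) ^ α ≤ 2 ^ (2 : ℝ) := Real.rpow_le_rpow_of_exponent_le (by norm_num) hα₂
      _ = 4 := by norm_num
  have h1 : N ^ α ≤ 8 * jbb α n := by
    calc N ^ α ≤ (2 * jb n) ^ α := by gcongr
      _ = 2 ^ α * jb n ^ α := Real.mul_rpow (by norm_num) (by linarith)
      _ ≤ 4 * (2 * jbb α n) := by
          gcongr
          linarith [half_rpow_jb_le_jbb (by linarith : 0 ≤ α) n]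
      _ = _ := by ring
  have h2 : (jbb α n)⁻¹ ≤ 8 * (N ^ α)⁻¹ := by
    rw [← div_eq_mul_inv, inv_eq_one_div, div_le_div_iff₀ hpos (by positivity)]
    linarith
  have h3 : N ^ (-(2 * α)) = ((N ^ α)⁻¹) ^ 2 := by
    rw [Real.rpow_neg (by linarith), inv_pow, ← Real.rpow_natCast (N ^ α),
      ← Real.rpow_mul (by linarith), mul_comm]
    norm_num
  have h5 : jbb α n ^ (-2 : ℝ) = ((jbb α n)⁻¹) ^ 2 := by
    rw [Real.rpow_neg hpos.le, inv_pow]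
    norm_num
  rw [h3, h5]
  calc ((jbb α n)⁻¹) ^ 2 ≤ (8 * (N ^ α)⁻¹) ^ 2 := by gcongr
    _ = _ := by ring

end conclusion

/-- **Basic resonance estimate** (Lemma 3.8): for `1 < α ≤ 2` there exist `θ > 0` and
`C > 0`, depending only on `α` (uniform in the choice of signs), such that for all
`n₁, n₂ ∈ ℤ³` and all dyadic `N₃ ≥ 1`,
`Σ_{n' ∈ ℤ} Σ_{n₃ ∈ ℤ³} ⟨n'⟩⁻¹ 1_{|n₃|∼N₃} ⟪n₁+n₂+n₃⟫⁻¹ ⟪n₃⟫⁻² 1_{|κ₂−n'|≤1}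
  ≤ C · N₃^{−θ} · ⟨n₁+n₂⟩^{−α}`. -/
theorem basic_resonance (α : ℝ) (hα₁ : 1 < α) (hα₂ : α ≤ 2) :
    ∃ θ C : ℝ, 0 < θ ∧ 0 < C ∧
      ∀ ε123 ε1 ε2 ε3 : ℝ, IsSign ε123 → IsSign ε1 → IsSign ε2 → IsSign ε3 →
        ∀ n₁ n₂ : Fin 3 → ℤ, ∀ N₃ : ℝ, IsDyadic N₃ →
          (∑' p : ℤ × (Fin 3 → ℤ),
              (rjb (p.1 : ℝ))⁻¹ * ind (SimFreq N₃ p.2) *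
                (jbb α (n₁ + n₂ + p.2))⁻¹ * jbb α p.2 ^ (-2 : ℝ) *
                ind (|ε123 * jbb α (n₁ + n₂ + p.2) + ε1 * jbb α n₁ +
                      ε2 * jbb α n₂ + ε3 * jbb α p.2 - (p.1 : ℝ)| ≤ 1))
            ≤ C * N₃ ^ (-θ) * jb (n₁ + n₂) ^ (-α) := by
  obtain ⟨C, hC0, hC⟩ := exists_sum_weighted_le hα₁ hα₂
  refine ⟨(α - 1) / 2, 3072 * C, by linarith, by positivity, ?_⟩
  intro ε123 ε1 ε2 ε3 h123 _ _ h3 n₁ n₂ N hdyadic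
  classical
  have hN : 1 ≤ N := by
    obtain ⟨j, rfl⟩ := hdyadic
    exact one_le_pow₀ (by norm_num)
  have hN0 : 0 < N := by linarith
  have hα0 : 0 ≤ α := by linarith
  set m := n₁ + n₂
  have hjm := one_le_jb m
  set c := ε123 * (ε1 * jbb α n₁ + ε2 * jbb α n₂)
  set σ := -(ε123 * ε3) with hσ
  have hσ' : σ = 1 ∨ σ = -1 := by
    rcases h123 with rfl | rfl <;> rcases h3 with rfl | rfl <;> norm_num [hσ]
  set κ : (Fin 3 → ℤ) → ℝ := fun n =>
    ε123 * jbb α (m + n) + ε1 * jbb α n₁ + ε2 * jbb α n₂ + ε3 * jbb α n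
  set w : (Fin 3 → ℤ) → ℝ := fun n => jb (m + n) ^ (-α) * (1 + |phase α σ m n + c|)⁻¹
  have hphase : ∀ n, |phase α σ m n + c| ≤ |κ n| + 2 := fun n => by
    have h := abs_phase_add_le hα₁ hα₂ h123 h3 m n (ε1 * jbb α n₁ + ε2 * jbb α n₂)
    rwa [← add_assoc] at h
  have hnonneg : ∀ p : ℤ × (Fin 3 → ℤ), 0 ≤ (rjb (p.1 : ℝ))⁻¹ * ind (SimFreq N p.2) *
      (jbb α (m + p.2))⁻¹ * jbb α p.2 ^ (-2 : ℝ) * ind (|κ p.2 - (p.1 : ℝ)| ≤ 1) := fun p => by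
    have h1 := (jbb_pos hα0 (m + p.2)).le
    have h2 := (jbb_pos hα0 p.2).le
    have h3 := ind_nonneg (SimFreq N p.2)
    have h4 := ind_nonneg (|κ p.2 - (p.1 : ℝ)| ≤ 1)
    have h5 : 0 ≤ rjb (p.1 : ℝ) := Real.sqrt_nonneg _
    positivity
  have hfiber : ∀ (s : Finset ℤ) (n : Fin 3 → ℤ), ∑ k ∈ s, (rjb (k : ℝ))⁻¹ * ind (SimFreq N n) *
      (jbb α (m + n))⁻¹ * jbb α n ^ (-2 : ℝ) * ind (|κ n - (k : ℝ)| ≤ 1) ≤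
      if SimFreq N n then 3072 * N ^ (-(2 * α)) * w n else 0 := by
    intro s n
    split_ifs with hn
    · have hj := one_le_jb (m + n)
      have hw : (jbb α (m + n))⁻¹ * jbb α n ^ (-2 : ℝ) ≤
          2 * jb (m + n) ^ (-α) * (64 * N ^ (-(2 * α))) :=
        mul_le_mul (inv_jbb_le hα0 _) (jbb_rpow_neg_two_le hα₁ hα₂ hN (hn.bounds hN).2)
          (Real.rpow_nonneg (jbb_pos hα0 n).le _) (by positivity)
      have hw0 : 0 ≤ (jbb α (m + n))⁻¹ * jbb α n ^ (-2 : ℝ) := by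
        have := (jbb_pos hα0 (m + n)).le
        have := (jbb_pos hα0 n).le
        positivity
      have hsum : ∑ k ∈ s, (rjb (k : ℝ))⁻¹ * ind (|κ n - (k : ℝ)| ≤ 1) ≤
          8 * (1 + |phase α σ m n + c|)⁻¹ * 3 := by
        refine (Finset.sum_le_sum fun k _ => inv_rjb_mul_ind_le (hphase n)).trans ?_
        rw [← Finset.mul_sum]
        exact mul_le_mul_of_nonneg_left (sum_ind_abs_sub_le _ s) (by positivity)
      calc _ = ((jbb α (m + n))⁻¹ * jbb α n ^ (-2 : ℝ)) *
            ∑ k ∈ s, (rjb (k : ℝ))⁻¹ * ind (|κ n - (k : ℝ)| ≤ 1) := by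
            rw [Finset.mul_sum]
            refine Finset.sum_congr rfl fun k _ => ?_
            rw [show ind (SimFreq N n) = 1 from if_pos hn]
            ring
        _ ≤ (2 * jb (m + n) ^ (-α) * (64 * N ^ (-(2 * α)))) *
            (8 * (1 + |phase α σ m n + c|)⁻¹ * 3) :=
            mul_le_mul hw hsum (Finset.sum_nonneg fun k _ =>
              mul_nonneg (inv_nonneg.mpr (Real.sqrt_nonneg _)) (ind_nonneg _)) (by positivity)
        _ = _ := by ring
    · rw [show ind (SimFreq N n) = 0 from if_neg hn]
      simp
  refine Real.tsum_le_of_sum_le hnonneg fun s => ?_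
  set X := (s.image Prod.snd).filter (SimFreq N)
  have hmain := hC σ hσ' m c N hN X (fun n hn => ((Finset.mem_filter.mp hn).2.bounds hN).1)
    (fun n hn => ((Finset.mem_filter.mp hn).2.bounds hN).2)
  have hmain' : jb m ^ α * ∑ n ∈ X, w n ≤ C * N ^ (2 * α - (α - 1) / 2) := by
    refine le_trans (le_of_eq ?_) hmain
    rw [Finset.mul_sum]
    exact Finset.sum_congr rfl fun n _ => by ring
  calc _ ≤ ∑ p ∈ s.image Prod.fst ×ˢ s.image Prod.snd, (rjb (p.1 : ℝ))⁻¹ * ind (SimFreq N p.2) *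
        (jbb α (m + p.2))⁻¹ * jbb α p.2 ^ (-2 : ℝ) * ind (|κ p.2 - (p.1 : ℝ)| ≤ 1) :=
        Finset.sum_le_sum_of_subset_of_nonneg Finset.subset_product fun p _ _ => hnonneg p
    _ ≤ ∑ n ∈ s.image Prod.snd, if SimFreq N n then 3072 * N ^ (-(2 * α)) * w n else 0 := by
        rw [Finset.sum_product_right]
        exact Finset.sum_le_sum fun n _ => hfiber _ n
    _ = 3072 * N ^ (-(2 * α)) * jb m ^ (-α) * (jb m ^ α * ∑ n ∈ X, w n) := by
        rw [← Finset.sum_filter, ← Finset.mul_sum, mul_assoc _ (jb m ^ (-α)),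
          ← mul_assoc (jb m ^ (-α)), ← Real.rpow_add (by linarith), neg_add_cancel,
          Real.rpow_zero, one_mul]
    _ ≤ 3072 * N ^ (-(2 * α)) * jb m ^ (-α) * (C * N ^ (2 * α - (α - 1) / 2)) := by gcongr
    _ = 3072 * C * (N ^ (-(2 * α)) * N ^ (2 * α - (α - 1) / 2)) * jb m ^ (-α) := by ring
    _ = _ := by
        rw [← Real.rpow_add hN0]
        congr 3
        ring
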